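/- Let n ≥ 1 and let (Ω, 𝓕, P) be a probability space equipped with a filtration (𝓕_t)_{t ∈ ℕ}. Let (r_s) be random vectors in ℝ^n and (C_s), (H_s) random n×n real matrices such that, for every s ≥ 1, C_s and H_s are 𝓕_{s-1}-measurable, E[r_s r_sᵀ | 𝓕_{s-1}] = H_s almost surely, and H_s = C Cᵀ + C_s C_sᵀ + a r_{s-1} r_{s-1}ᵀ + b H_{s-1}, where C is a fixed n×n real matrix and a, b ≥ 0 with a + b < 1. Assume all matrices involved are integrable and ‖C_s C_sᵀ‖_F ≤ M' almost surely for all s, and set M := ‖C Cᵀ‖_F + M'. Then for every t ≥ 1 and every k ≥ 1, ‖E[H_{t+k} | 𝓕_{t-1}]‖_F ≤ ((1 − (a+b)^k)/(1 − a − b)) · M + (a+b)^k · ‖H_t‖_F almost surely. -/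

import Mathlib

open MeasureTheory Matrix

/-- Frobenius norm of an `n × n` real matrix. -/
noncomputable def frobNorm {n : ℕ} (A : Matrix (Fin n) (Fin n) ℝ) : ℝ :=
  Real.sqrt (∑ i, ∑ j, (A i j) ^ 2)

theorem frobNorm_eq_norm_toLp {n : ℕ} (A : Matrix (Fin n) (Fin n) ℝ) :
    frobNorm A = ‖WithLp.toLp 2 fun p : Fin n × Fin n => A p.1 p.2‖ := by
  simp [frobNorm, EuclideanSpace.norm_eq, Fintype.sum_prod_type]

theorem frobNorm_add_le {n : ℕ} (A B : Matrix (Fin n) (Fin n) ℝ) :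
    frobNorm (A + B) ≤ frobNorm A + frobNorm B := by
  simp only [frobNorm_eq_norm_toLp]
  exact norm_add_le (WithLp.toLp 2 fun p : Fin n × Fin n => A p.1 p.2)
    (WithLp.toLp 2 fun p : Fin n × Fin n => B p.1 p.2)

theorem frobNorm_smul {n : ℕ} {c : ℝ} (hc : 0 ≤ c) (A : Matrix (Fin n) (Fin n) ℝ) :
    frobNorm (c • A) = c * frobNorm A := by
  simp only [frobNorm_eq_norm_toLp]
  rw [← Real.norm_of_nonneg hc, ← norm_smul, Real.norm_of_nonneg hc]
  rfl

/-- The entrywise conditional expectation of a random matrix. -/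
noncomputable def matrixCondExp {n : ℕ} {Ω : Type*} (m : MeasurableSpace Ω)
    {m0 : MeasurableSpace Ω} (μ : Measure Ω) (X : Ω → Matrix (Fin n) (Fin n) ℝ) (x : Ω) :
    Matrix (Fin n) (Fin n) ℝ :=
  Matrix.of fun i j => (μ[fun y => X y i j | m]) x

/-- Entrywise conditional expectation preserves almost sure bounds on the Frobenius norm. -/
theorem frobNorm_matrixCondExp_le {n : ℕ} {Ω : Type*} {m m0 : MeasurableSpace Ω}
    {μ : Measure Ω} [IsProbabilityMeasure μ] {X : Ω → Matrix (Fin n) (Fin n) ℝ}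
    (hX : ∀ i j, Integrable (fun x => X x i j) μ) {R : ℝ}
    (hR : ∀ᵐ x ∂μ, frobNorm (X x) ≤ R) :
    ∀ᵐ x ∂μ, frobNorm (matrixCondExp m μ X x) ≤ R := by
  let Y : Ω → EuclideanSpace ℝ (Fin n × Fin n) :=
    fun x => WithLp.toLp 2 fun p => X x p.1 p.2
  have hY : Integrable Y μ := Integrable.of_eval_piLp fun p => hX p.1 p.2
  have hentry : ∀ᵐ x ∂μ, ∀ p : Fin n × Fin n,
      (μ[Y | m]) x p = (μ[fun y => X y p.1 p.2 | m]) x :=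
    ae_all_iff.2 fun p => (EuclideanSpace.proj (𝕜 := ℝ) p).comp_condExp_comm hY
  have hbound : ∀ᵐ x ∂μ, ‖(μ[Y | m]) x‖ ≤ R :=
    ae_bdd_norm_condExp_of_ae_bdd_norm (hR.mono fun x hx => by rwa [frobNorm_eq_norm_toLp] at hx)
  filter_upwards [hentry, hbound] with x hx hb
  rw [frobNorm_eq_norm_toLp]
  convert hb using 2
  ext p
  exact (hx p).symm

/-- The conditional expectation of the recursion: given an earlier time `u`, one step of the
recursion maps the conditional mean `G` to `D + E[Z | 𝓕_u] + (a + b) G`. -/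
theorem matrixCondExp_recursion {n : ℕ} {Ω : Type*} {m m' m0 : MeasurableSpace Ω}
    {μ : Measure Ω} [IsProbabilityMeasure μ] (hmm' : m ≤ m') (hm' : m' ≤ m0)
    {Z R H H' : Ω → Matrix (Fin n) (Fin n) ℝ} (D : Matrix (Fin n) (Fin n) ℝ) (a b : ℝ)
    (hZ : ∀ i j, Integrable (fun x => Z x i j) μ)
    (hR : ∀ i j, Integrable (fun x => R x i j) μ)
    (hH : ∀ i j, Integrable (fun x => H x i j) μ)
    (hcond : ∀ i j, μ[fun x => R x i j | m'] =ᵐ[μ] fun x => H x i j)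
    (hrec : ∀ x, H' x = D + Z x + a • R x + b • H x) :
    ∀ᵐ x ∂μ, matrixCondExp m μ H' x =
      D + matrixCondExp m μ Z x + (a + b) • matrixCondExp m μ H x := by
  have hentry : ∀ᵐ x ∂μ, ∀ i j, (μ[fun y => H' y i j | m]) x =
      D i j + (μ[fun y => Z y i j | m]) x + (a + b) * (μ[fun y => H y i j | m]) x := by
    refine ae_all_iff.2 fun i => ae_all_iff.2 fun j => ?_
    have hfun : (fun y => H' y i j) = (fun _ => D i j) + (fun y => Z y i j)
        + a • (fun y => R y i j) + b • (fun y => H y i j) := by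
      ext y
      simp [hrec]
    have htower : μ[fun y => R y i j | m] =ᵐ[μ] μ[fun y => H y i j | m] :=
      (condExp_condExp_of_le hmm' hm').symm.trans (condExp_congr_ae (hcond i j))
    have hD : Integrable (fun _ : Ω => D i j) μ := integrable_const _
    rw [hfun]
    filter_upwards [htower,
      condExp_add ((hD.add (hZ i j)).add ((hR i j).smul a)) ((hH i j).smul b) m,
      condExp_add (hD.add (hZ i j)) ((hR i j).smul a) m,
      condExp_add hD (hZ i j) m,
      condExp_smul (μ := μ) a (fun y => R y i j) m,
      condExp_smul (μ := μ) b (fun y => H y i j) m] with x h₁ h₂ h₃ h₄ h₅ h₆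
    simp only [Pi.add_apply, Pi.smul_apply, smul_eq_mul] at h₂ h₃ h₄ h₅ h₆
    rw [h₂, h₃, h₄, h₅, h₆, h₁, condExp_const (hmm'.trans hm')]
    ring
  filter_upwards [hentry] with x hx
  ext i j
  simpa [matrixCondExp] using hx i j

/-- Conditional form of Theorem 1 of the paper: for the LSTM-BEKK recursion
`H_s = C Cᵀ + C_s C_sᵀ + a r_{s-1} r_{s-1}ᵀ + b H_{s-1}` with `a, b ≥ 0`,
`a + b < 1` and `‖C_s C_sᵀ‖_F ≤ M'` a.s., one has, with `M = ‖C Cᵀ‖_F + M'`,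
`‖E[H_{t+k} | 𝓕_{t-1}]‖_F ≤ ((1 - (a+b)^k)/(1 - a - b)) M + (a+b)^k ‖H_t‖_F`
a.s. for every `t ≥ 1` and `k ≥ 1`. -/
theorem stmt_4 {n : ℕ} (hn : 1 ≤ n)
    {Ω : Type*} {m0 : MeasurableSpace Ω} {μ : Measure Ω} [IsProbabilityMeasure μ]
    (ℱ : Filtration ℕ m0)
    (r : ℕ → Ω → Fin n → ℝ)
    (Cdyn H : ℕ → Ω → Matrix (Fin n) (Fin n) ℝ)
    (C : Matrix (Fin n) (Fin n) ℝ)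
    (a b : ℝ) (ha : 0 ≤ a) (hb : 0 ≤ b) (hab : a + b < 1)
    (hmeasC : ∀ s : ℕ, 1 ≤ s → ∀ i j : Fin n,
      StronglyMeasurable[ℱ (s - 1)] fun x => Cdyn s x i j)
    (hmeasH : ∀ s : ℕ, 1 ≤ s → ∀ i j : Fin n,
      StronglyMeasurable[ℱ (s - 1)] fun x => H s x i j)
    (hcond : ∀ s : ℕ, 1 ≤ s → ∀ i j : Fin n,
      μ[fun x => r s x i * r s x j | ℱ (s - 1)] =ᵐ[μ] fun x => H s x i j)
    (hrec : ∀ s : ℕ, 1 ≤ s → ∀ x : Ω,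
      H s x = C * Cᵀ + Cdyn s x * (Cdyn s x)ᵀ
        + a • vecMulVec (r (s - 1) x) (r (s - 1) x) + b • H (s - 1) x)
    (hint_rr : ∀ s : ℕ, ∀ i j : Fin n, Integrable (fun x => r s x i * r s x j) μ)
    (hint_C : ∀ s : ℕ, ∀ i j : Fin n,
      Integrable (fun x => (Cdyn s x * (Cdyn s x)ᵀ) i j) μ)
    (hint_H : ∀ s : ℕ, ∀ i j : Fin n, Integrable (fun x => H s x i j) μ)
    (M' : ℝ) (hM' : ∀ s : ℕ, ∀ᵐ x ∂μ, frobNorm (Cdyn s x * (Cdyn s x)ᵀ) ≤ M')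
    (M : ℝ) (hM : M = frobNorm (C * Cᵀ) + M') :
    ∀ t : ℕ, 1 ≤ t → ∀ k : ℕ, 1 ≤ k →
      ∀ᵐ x ∂μ,
        frobNorm (Matrix.of fun i j : Fin n =>
            (μ[fun y => H (t + k) y i j | ℱ (t - 1)]) x)
          ≤ ((1 - (a + b) ^ k) / (1 - a - b)) * M + (a + b) ^ k * frobNorm (H t x) := by
  intro t ht k _
  have hone : (1 - a - b) ≠ 0 := by linarith
  suffices hind : ∀ k : ℕ, ∀ᵐ x ∂μ, frobNorm (matrixCondExp (ℱ (t - 1)) μ (H (t + k)) x)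
      ≤ ((1 - (a + b) ^ k) / (1 - a - b)) * M + (a + b) ^ k * frobNorm (H t x) from hind k
  intro k
  induction k with
  | zero =>
    refine Filter.Eventually.of_forall fun x => ?_
    have hH : matrixCondExp (ℱ (t - 1)) μ (H t) x = H t x := by
      ext i j
      exact congrFun
        (condExp_of_stronglyMeasurable (ℱ.le _) (hmeasH t ht i j) (hint_H t i j)) x
    simp [hH]
  | succ k ih =>
    have hstep := matrixCondExp_recursion (μ := μ) (ℱ.mono (by omega : t - 1 ≤ t + k - 1))
      (ℱ.le _) (Z := fun x => Cdyn (t + k + 1) x * (Cdyn (t + k + 1) x)ᵀ)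
      (R := fun x => vecMulVec (r (t + k) x) (r (t + k) x)) (H := H (t + k))
      (H' := H (t + k + 1)) (C * Cᵀ) a b (hint_C _)
      (fun i j => by simpa only [vecMulVec_apply] using hint_rr (t + k) i j) (hint_H _)
      (fun i j => by simpa only [vecMulVec_apply] using hcond (t + k) (by omega) i j)
      (hrec (t + k + 1) (by omega))
    have hC := frobNorm_matrixCondExp_le (m := ℱ (t - 1)) (hint_C (t + k + 1))
      (hM' (t + k + 1))
    filter_upwards [ih, hstep, hC] with x hih hx hCx
    rw [← add_assoc, hx]
    calc _ ≤ frobNorm (C * Cᵀ) + M' + (a + b) *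
          (((1 - (a + b) ^ k) / (1 - a - b)) * M + (a + b) ^ k * frobNorm (H t x)) := by
          refine (frobNorm_add_le _ _).trans (add_le_add ((frobNorm_add_le _ _).trans ?_) ?_)
          · gcongr
          · rw [frobNorm_smul (add_nonneg ha hb)]
            gcongr
      _ = _ := by
          rw [← hM]
          field_simp
          ring
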